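/- arXiv:1408.6981 — 3 statements merged into one kernel-verified Lean document; each statement's English description precedes it below -/
import Mathlib

section
/- Let X₁ = X₂ = Y₁ = Y₂ = ℂ² and let ε ∈ [0,1]. There exists a separable measurement {P₁, P₂, P₃} on (X₁⊗X₂) : (Y₁⊗Y₂) whose success probability at discriminating the three states φ_k ⊗ τ_ε (k = 1, 2, 3) with uniform prior 1/3 equals (2 + √(1 − ε²))/3; that is, (1/3) Σ_{k=1}^{3} ⟨φ_k ⊗ τ_ε, W P_k W*⟩ = (2 + √(1 − ε²))/3, so the bound (2 + √(1 − ε²))/3 is optimal for separable measurements. -/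
open Matrix Complex
open scoped Matrix Kronecker ComplexOrder

noncomputable section

/-- The tensor (Kronecker) product of two vectors. -/
def tens {α β : Type*} (u : α → ℂ) (v : β → ℂ) : α × β → ℂ := fun p => u p.1 * v p.2

/-- The rank-one operator `u u*`. -/
def proj {α : Type*} (u : α → ℂ) : Matrix α α ℂ := Matrix.vecMulVec u (star u)

/-- A separable (positive semidefinite) operator with respect to the bipartition `α : β`. -/
def SepMat {α β : Type*} [Fintype α] [Fintype β] (P : Matrix (α × β) (α × β) ℂ) : Prop :=
  ∃ (M : ℕ) (Q : Fin M → Matrix α α ℂ) (R : Fin M → Matrix β β ℂ),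
    (∀ j, (Q j).PosSemidef) ∧ (∀ j, (R j).PosSemidef) ∧ P = ∑ j, Q j ⊗ₖ R j

/-- The operator `(1 ⊗ y)* H (1 ⊗ y)` on the first factor. -/
def blockCompress {α β : Type*} [Fintype β] (H : Matrix (α × β) (α × β) ℂ) (y : β → ℂ) :
    Matrix α α ℂ :=
  Matrix.of fun i j => ∑ a, ∑ b, star (y a) * H (i, a) (j, b) * y b

/-- Block positivity with respect to the bipartition `α : β`. -/
def BlockPositive {α β : Type*} [Fintype α] [Fintype β] (H : Matrix (α × β) (α × β) ℂ) : Prop :=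
  ∀ y : β → ℂ, (blockCompress H y).PosSemidef

/-- Partial transposition on the first tensor factor. -/
def ptFst {α β : Type*} (M : Matrix (α × β) (α × β) ℂ) : Matrix (α × β) (α × β) ℂ :=
  Matrix.of fun r c => M (c.1, r.2) (r.1, c.2)

/-- The four Bell states on two qubits. -/
def bellVec : Fin 4 → (Fin 2 × Fin 2) → ℂ :=
  ![fun p => if p.1 = p.2 then ((Real.sqrt 2 : ℂ))⁻¹ else 0,
    fun p => if p = (0, 0) then ((Real.sqrt 2 : ℂ))⁻¹
             else if p = (1, 1) then -((Real.sqrt 2 : ℂ))⁻¹ else 0,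
    fun p => if p.1 ≠ p.2 then ((Real.sqrt 2 : ℂ))⁻¹ else 0,
    fun p => if p = (0, 1) then ((Real.sqrt 2 : ℂ))⁻¹
             else if p = (1, 0) then -((Real.sqrt 2 : ℂ))⁻¹ else 0]

/-- The ancillary resource state `|τ_ε⟩ = √((1+ε)/2)|00⟩ + √((1−ε)/2)|11⟩`. -/
def tauVec (ε : ℝ) : (Fin 2 × Fin 2) → ℂ :=
  fun p => if p = (0, 0) then (Real.sqrt ((1 + ε) / 2) : ℂ)
           else if p = (1, 1) then (Real.sqrt ((1 - ε) / 2) : ℂ) else 0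

/-- Conjugation by the swap unitary `W` exchanging the two middle tensor factors:
if `M` is indexed with grouping `((a₁, a₂), (b₁, b₂))`, the result is indexed with
grouping `((a₁, b₁), (a₂, b₂))`. -/
def regroup {α₁ α₂ β₁ β₂ : Type*}
    (M : Matrix ((α₁ × α₂) × (β₁ × β₂)) ((α₁ × α₂) × (β₁ × β₂)) ℂ) :
    Matrix ((α₁ × β₁) × (α₂ × β₂)) ((α₁ × β₁) × (α₂ × β₂)) ℂ :=
  Matrix.of fun r c =>
    M ((r.1.1, r.2.1), (r.1.2, r.2.2)) ((c.1.1, c.2.1), (c.1.2, c.2.2))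

lemma aux_proj_psd {α : Type*} [Fintype α] (u : α → ℂ) : (proj u).PosSemidef :=
  Matrix.posSemidef_vecMulVec_self_star u

/-- Bob's Bell outcome `i` and Alice's Bell outcome `j` determine the guess. -/
def auxGuess : Fin 4 → Fin 4 → Fin 3 :=
  ![![0, 1, 2, 2], ![1, 0, 2, 2], ![2, 2, 0, 1], ![2, 2, 1, 0]]

def auxR (k : Fin 3) (j : Fin 4) : Matrix (Fin 2 × Fin 2) (Fin 2 × Fin 2) ℂ :=
  ∑ i, if auxGuess j i = k then proj (bellVec i) else 0

def auxAmp (u v a b : Fin 2 × Fin 2 → ℂ) : ℂ :=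
  ∑ x : Fin 2, ∑ y : Fin 2, ∑ x' : Fin 2, ∑ y' : Fin 2,
    star (u (x, y) * v (x', y')) * (a (x, x') * b (y, y'))

lemma aux_sq2 : ((Real.sqrt 2 : ℂ))⁻¹ * ((Real.sqrt 2 : ℂ))⁻¹ = 1 / 2 := by
  rw [← mul_inv, ← Complex.ofReal_mul, Real.mul_self_sqrt (by norm_num)]
  norm_num

lemma aux_sum_bell : ∑ i, proj (bellVec i) = 1 := by
  ext ⟨a, b⟩ ⟨c, d⟩
  have h := aux_sq2
  fin_cases a <;> fin_cases b <;> fin_cases c <;> fin_cases d <;>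
    simp [Fin.sum_univ_four, proj, bellVec, Matrix.vecMulVec_apply, h, Complex.conj_ofReal] <;>
    norm_num

lemma aux_trace (u v a b : Fin 2 × Fin 2 → ℂ) :
    (((proj u ⊗ₖ proj v) * regroup (proj a ⊗ₖ proj b)).trace).re
      = Complex.normSq (auxAmp u v a b) := by
  set w : (Fin 2 × Fin 2) × (Fin 2 × Fin 2) → ℂ :=
    fun r => a (r.1.1, r.2.1) * b (r.1.2, r.2.2) with hw
  have h1 : proj u ⊗ₖ proj v = proj (tens u v) := by
    ext ⟨r, s⟩ ⟨t, q⟩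
    simp [proj, tens, Matrix.vecMulVec_apply]; ring
  have h2 : regroup (proj a ⊗ₖ proj b) = proj w := by
    ext r s
    simp [proj, regroup, hw, Matrix.vecMulVec_apply]; ring
  have h3 : auxAmp u v a b = star (tens u v) ⬝ᵥ w := by
    simp [auxAmp, dotProduct, tens, hw, Fintype.sum_prod_type]
  have h4 : (proj (tens u v) * proj w).trace
      = (star (tens u v) ⬝ᵥ w) * star (star (tens u v) ⬝ᵥ w) := by
    rw [proj, proj, Matrix.vecMulVec_mul_vecMulVec, Matrix.trace_vecMulVec]
    rw [dotProduct_smul, smul_eq_mul]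
    congr 1
    simp [dotProduct, mul_comm]
  rw [h1, h2, h4, h3]
  simp only [Complex.star_def, Complex.mul_conj, Complex.ofReal_re]

lemma aux_regroup_sum {ι : Type*} (s : Finset ι)
    (M : ι → Matrix ((Fin 2 × Fin 2) × (Fin 2 × Fin 2)) ((Fin 2 × Fin 2) × (Fin 2 × Fin 2)) ℂ) :
    regroup (∑ i ∈ s, M i) = ∑ i ∈ s, regroup (M i) := by
  ext r c
  simp [regroup, Matrix.sum_apply]

lemma aux_prob (u v : Fin 2 × Fin 2 → ℂ) (k : Fin 3) :
    (((proj u ⊗ₖ proj v) * regroup (∑ j, proj (bellVec j) ⊗ₖ auxR k j)).trace).re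
      = ∑ j, ∑ i, if auxGuess j i = k
          then Complex.normSq (auxAmp u v (bellVec j) (bellVec i)) else 0 := by
  have h : ∀ j, proj (bellVec j) ⊗ₖ auxR k j
      = ∑ i, if auxGuess j i = k then proj (bellVec j) ⊗ₖ proj (bellVec i) else 0 := by
    intro j
    ext r c
    simp only [auxR, Matrix.kroneckerMap_apply, Matrix.sum_apply, Finset.mul_sum]
    refine Finset.sum_congr rfl fun i _ => ?_
    split_ifs <;> simp
  simp only [h, aux_regroup_sum, Finset.mul_sum, Matrix.trace_sum, Complex.re_sum]
  refine Finset.sum_congr rfl fun j _ => Finset.sum_congr rfl fun i _ => ?_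
  split_ifs
  · exact aux_trace _ _ _ _
  · have : regroup (0 : Matrix ((Fin 2 × Fin 2) × (Fin 2 × Fin 2))
        ((Fin 2 × Fin 2) × (Fin 2 × Fin 2)) ℂ) = 0 := rfl
    simp [this]

/-- There is a separable measurement whose success probability at discriminating the three
Bell states `φ₁, φ₂, φ₃` assisted by the resource state `τ_ε` (uniform prior) is exactly
`(2 + √(1 − ε²))/3`, so this bound is optimal for separable measurements. -/
theorem three_bell_sep_bound_attained (ε : ℝ) (hε : ε ∈ Set.Icc (0 : ℝ) 1) :
    ∃ P : Fin 3 → Matrix ((Fin 2 × Fin 2) × (Fin 2 × Fin 2))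
      ((Fin 2 × Fin 2) × (Fin 2 × Fin 2)) ℂ,
      (∀ k, SepMat (P k)) ∧ (∑ k, P k = 1) ∧
      (1 / 3 : ℝ) * ∑ k : Fin 3,
          (((proj (bellVec k.castSucc) ⊗ₖ proj (tauVec ε)) * regroup (P k)).trace).re =
        (2 + Real.sqrt (1 - ε ^ 2)) / 3 := by
  refine ⟨fun k => ∑ j, proj (bellVec j) ⊗ₖ auxR k j, ?_, ?_, ?_⟩
  · intro k
    refine ⟨4, fun j => proj (bellVec j), auxR k, fun j => aux_proj_psd _, fun j => ?_, rfl⟩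
    refine Matrix.posSemidef_sum _ fun i _ => ?_
    split_ifs
    · exact aux_proj_psd _
    · exact Matrix.PosSemidef.zero
  · have hR : ∀ j, ∑ k, auxR k j = 1 := by
      intro j
      rw [← aux_sum_bell]
      simp only [auxR]
      rw [Finset.sum_comm]
      simp
    rw [Finset.sum_comm]
    have : ∀ j, ∑ k, proj (bellVec j) ⊗ₖ auxR k j = proj (bellVec j) ⊗ₖ 1 := by
      intro j
      rw [← hR j]
      ext r c
      simp [Matrix.sum_apply, Finset.mul_sum]
    simp only [this]
    have h2 : ∑ j, proj (bellVec j) ⊗ₖ (1 : Matrix (Fin 2 × Fin 2) (Fin 2 × Fin 2) ℂ)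
        = (∑ j, proj (bellVec j)) ⊗ₖ (1 : Matrix (Fin 2 × Fin 2) (Fin 2 × Fin 2) ℂ) := by
      ext r c
      simp [Matrix.sum_apply, Finset.sum_mul]
    rw [h2, aux_sum_bell, Matrix.one_kronecker_one]
  · simp only [aux_prob]
    obtain ⟨h0, h1⟩ := hε
    set a := Real.sqrt ((1 + ε) / 2) with ha
    set b := Real.sqrt ((1 - ε) / 2) with hb
    have ha2 : a * a = (1 + ε) / 2 := Real.mul_self_sqrt (by linarith)
    have hb2 : b * b = (1 - ε) / 2 := Real.mul_self_sqrt (by linarith)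
    have hab : Real.sqrt (1 - ε ^ 2) = 2 * (a * b) := by
      rw [ha, hb, ← Real.sqrt_mul (by linarith), Real.sqrt_eq_iff_mul_self_eq (by nlinarith)
        (by positivity)]
      have := Real.mul_self_sqrt (show 0 ≤ (1 + ε) / 2 * ((1 - ε) / 2) by nlinarith)
      nlinarith
    have hs : (Real.sqrt 2)⁻¹ * (Real.sqrt 2)⁻¹ = 1 / 2 := by
      rw [← mul_inv, Real.mul_self_sqrt (by norm_num)]; norm_num
    rw [hab]
    set s := (Real.sqrt 2)⁻¹ with hsd
    have hs2 : s ^ 2 = 1 / 2 := by rw [sq, hs]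
    simp [Fin.sum_univ_three, Fin.sum_univ_four, Fin.sum_univ_two, auxGuess, auxAmp, bellVec,
      tauVec, Complex.normSq_apply, ← ha, ← hb]
    ring_nf
    have h6 : Real.sqrt 2 ^ 6 = 8 := by
      have h2 : Real.sqrt 2 ^ 2 = 2 := Real.sq_sqrt (by norm_num)
      rw [show Real.sqrt 2 ^ 6 = (Real.sqrt 2 ^ 2) ^ 3 by ring, h2]
      norm_num
    rw [h6]
    nlinarith
end
end

section
/- Let X₁ = X₂ = Y₁ = Y₂ = ℂ² and let ε ∈ [0,1]. There exists a separable (and hence PPT) measurement {P₁, P₂, P₃, P₄} on (X₁⊗X₂) : (Y₁⊗Y₂) whose success probability at discriminating the four states φ_k ⊗ τ_ε (k = 1, 2, 3, 4) with uniform prior 1/4 equals (1 + √(1 − ε²))/2; that is, (1/4) Σ_{k=1}^{4} ⟨φ_k ⊗ τ_ε, W P_k W*⟩ = (1 + √(1 − ε²))/2, so the bound (1 + √(1 − ε²))/2 is optimal. -/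
open Matrix Complex
open scoped Matrix Kronecker ComplexOrder

noncomputable section

/-- Bell completeness. -/
lemma bell_complete : ∑ k : Fin 4, proj (bellVec k) = 1 := by
  have h2 : ((Real.sqrt 2 : ℂ))⁻¹ * ((Real.sqrt 2 : ℂ))⁻¹ = 1 / 2 := by
    rw [← mul_inv, ← Complex.ofReal_mul, Real.mul_self_sqrt (by norm_num)]; norm_num
  ext ⟨a, b⟩ ⟨c, d⟩
  fin_cases a <;> fin_cases b <;> fin_cases c <;> fin_cases d <;>
    simp [Fin.sum_univ_four, proj, bellVec, Matrix.vecMulVec_apply, Matrix.one_apply, h2] <;> norm_num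

/-- The amplitude of `u ⊗ t` against the product vector `a : b`. -/
def amp (u t a b : Fin 2 × Fin 2 → ℂ) : ℂ :=
  ∑ x₁, ∑ y₁, ∑ x₂, ∑ y₂, u (x₁, y₁) * t (x₂, y₂) * star (a (x₁, x₂)) * star (b (y₁, y₂))

lemma trace_amp (u t a b : Fin 2 × Fin 2 → ℂ) :
    ((proj u ⊗ₖ proj t) * regroup (proj a ⊗ₖ proj b)).trace = amp u t a b * star (amp u t a b) := by
  have : ((proj u ⊗ₖ proj t) * regroup (proj a ⊗ₖ proj b))
      = Matrix.vecMulVec (tens u t)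
          (fun q => star (amp u t a b) * (star (a (q.1.1, q.2.1)) * star (b (q.1.2, q.2.2)))) := by
    ext p q
    simp only [Matrix.mul_apply, Matrix.vecMulVec_apply, tens, proj, regroup, Matrix.of_apply,
      Matrix.kroneckerMap_apply, Pi.star_apply, amp, star_sum, star_mul', star_star,
      Fintype.sum_prod_type, Finset.mul_sum, Finset.sum_mul]
    refine Finset.sum_congr rfl fun _ _ => Finset.sum_congr rfl fun _ _ =>
      Finset.sum_congr rfl fun _ _ => Finset.sum_congr rfl fun _ _ => ?_
    ring
  rw [this]
  generalize star (amp u t a b) = s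
  simp only [Matrix.trace, Matrix.diag, Matrix.vecMulVec_apply, tens, amp,
      Fintype.sum_prod_type, Finset.sum_mul]
  refine Finset.sum_congr rfl fun _ _ => Finset.sum_congr rfl fun _ _ =>
      Finset.sum_congr rfl fun _ _ => Finset.sum_congr rfl fun _ _ => ?_
  ring

/-- Multiplication table of the Pauli group modulo phases. -/
def xo : Fin 4 → Fin 4 → Fin 4 := ![![0, 1, 2, 3], ![1, 0, 3, 2], ![2, 3, 0, 1], ![3, 2, 1, 0]]

lemma amp_sq (ε : ℝ) (hε : ε ∈ Set.Icc (0 : ℝ) 1) (k j : Fin 4) :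
    (amp (bellVec k) (tauVec ε) (bellVec j) (bellVec (xo k j)) *
      star (amp (bellVec k) (tauVec ε) (bellVec j) (bellVec (xo k j)))).re =
      (1 + Real.sqrt (1 - ε ^ 2)) / 8 := by
  obtain ⟨h0, h1⟩ := hε
  have ha := Real.mul_self_sqrt (show 0 ≤ (1 + ε) / 2 by linarith)
  have hb := Real.mul_self_sqrt (show 0 ≤ (1 - ε) / 2 by linarith)
  have hab : 2 * (Real.sqrt ((1 + ε) / 2) * Real.sqrt ((1 - ε) / 2)) = Real.sqrt (1 - ε ^ 2) := by
    rw [← Real.sqrt_mul (show 0 ≤ (1 + ε) / 2 by linarith),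
      show 1 - ε ^ 2 = (2 : ℝ) ^ 2 * ((1 + ε) / 2 * ((1 - ε) / 2)) by ring,
      Real.sqrt_mul (show (0 : ℝ) ≤ 2 ^ 2 by norm_num) ((1 + ε) / 2 * ((1 - ε) / 2)),
      Real.sqrt_sq (show (0 : ℝ) ≤ 2 by norm_num)]
  have hr : (Real.sqrt 2)⁻¹ * (Real.sqrt 2)⁻¹ = 1 / 2 := by
    rw [← mul_inv, Real.mul_self_sqrt (by norm_num)]; norm_num
  have key : ∃ s : ℝ, s * s = 1 ∧ amp (bellVec k) (tauVec ε) (bellVec j) (bellVec (xo k j)) =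
      ((s * ((Real.sqrt ((1 + ε) / 2) + Real.sqrt ((1 - ε) / 2)) *
        ((Real.sqrt 2)⁻¹ * (Real.sqrt 2)⁻¹ * (Real.sqrt 2)⁻¹)) : ℝ) : ℂ) := by
    push_cast
    fin_cases k <;> fin_cases j <;>
    first
    | (refine ⟨1, by norm_num, ?_⟩
       simp [amp, Fin.sum_univ_two, bellVec, tauVec, xo]
       done)
    | (refine ⟨1, by norm_num, ?_⟩
       simp [amp, Fin.sum_univ_two, bellVec, tauVec, xo]
       ring1)
    | (refine ⟨-1, by norm_num, ?_⟩
       simp [amp, Fin.sum_univ_two, bellVec, tauVec, xo]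
       ring1)
  obtain ⟨s, hs, h⟩ := key
  rw [h]
  rw [Complex.star_def, Complex.conj_ofReal, ← Complex.ofReal_mul, Complex.ofReal_re, ← hab, hr]
  generalize Real.sqrt ((1 + ε) / 2) = a at *
  generalize Real.sqrt ((1 - ε) / 2) = b at *
  generalize (Real.sqrt 2)⁻¹ = r at *
  have e : s * ((a + b) * (1 / 2 * r)) * (s * ((a + b) * (1 / 2 * r)))
    = (s * s) * (r * r) * (1 / 4) * (a * a + b * b + 2 * (a * b)) := by ring
  rw [e, hs, hr, ha, hb]
  ring

lemma regroup_sum {n : ℕ} (F : Fin n → Matrix ((Fin 2 × Fin 2) × (Fin 2 × Fin 2))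
      ((Fin 2 × Fin 2) × (Fin 2 × Fin 2)) ℂ) : regroup (∑ j, F j) = ∑ j, regroup (F j) := by
  ext p q
  simp [regroup, Matrix.sum_apply]

/-- There is a separable (hence PPT) measurement whose success probability at discriminating
the four Bell states assisted by the resource state `τ_ε` (uniform prior) is exactly
`(1 + √(1 − ε²))/2`, so this bound is optimal. -/
theorem four_bell_bound_attained (ε : ℝ) (hε : ε ∈ Set.Icc (0 : ℝ) 1) :
    ∃ P : Fin 4 → Matrix ((Fin 2 × Fin 2) × (Fin 2 × Fin 2))
      ((Fin 2 × Fin 2) × (Fin 2 × Fin 2)) ℂ,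
      (∀ k, SepMat (P k)) ∧ (∑ k, P k = 1) ∧
      (1 / 4 : ℝ) * ∑ k : Fin 4,
          (((proj (bellVec k) ⊗ₖ proj (tauVec ε)) * regroup (P k)).trace).re =
        (1 + Real.sqrt (1 - ε ^ 2)) / 2 := by
  refine ⟨fun k => ∑ j, proj (bellVec j) ⊗ₖ proj (bellVec (xo k j)), ?_, ?_, ?_⟩
  · intro k
    exact ⟨4, fun j => proj (bellVec j), fun j => proj (bellVec (xo k j)),
      fun j => Matrix.posSemidef_vecMulVec_self_star _,
      fun j => Matrix.posSemidef_vecMulVec_self_star _, rfl⟩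
  · have h : ∀ j, ∑ k, proj (bellVec (xo k j)) = 1 := by
      intro j
      rw [← bell_complete]
      fin_cases j <;> simp [Fin.sum_univ_four, xo] <;> abel
    have h' : ∀ j : Fin 4, ∑ k, proj (bellVec j) ⊗ₖ proj (bellVec (xo k j))
        = proj (bellVec j) ⊗ₖ (1 : Matrix (Fin 2 × Fin 2) (Fin 2 × Fin 2) ℂ) := by
      intro j
      rw [← h j]
      ext p q
      simp [Matrix.sum_apply, Matrix.kroneckerMap_apply, Finset.mul_sum]
    rw [Finset.sum_comm, Finset.sum_congr rfl fun j _ => h' j]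
    have h3 : ∑ j, proj (bellVec j) ⊗ₖ (1 : Matrix (Fin 2 × Fin 2) (Fin 2 × Fin 2) ℂ)
        = (∑ j, proj (bellVec j)) ⊗ₖ (1 : Matrix (Fin 2 × Fin 2) (Fin 2 × Fin 2) ℂ) := by
      ext p q
      simp only [Matrix.sum_apply, Matrix.kroneckerMap_apply, Finset.sum_mul]
    rw [h3, bell_complete, Matrix.one_kronecker_one]
  · simp only [regroup_sum, Matrix.mul_sum, Matrix.trace_sum, Complex.re_sum, trace_amp,
      amp_sq ε hε]
    simp
    ring
end
end

section
/- Let A = {u_k ⊗ v_k : k = 1, …, N} ⊂ ℂ^n ⊗ ℂ^m be an unextendable product set, and for each k let P_k denote the set of rank-one product projections xx* ⊗ yy* with unit vectors x ∈ ℂ^n, y ∈ ℂ^m such that x ⊗ y is orthogonal to every element of A \ {u_k ⊗ v_k}. Then the following are equivalent: (1) there exists a separable measurement {P_1, …, P_N} on ℂ^n : ℂ^m with ⟨u_k u_k* ⊗ v_k v_k*, P_k⟩ = 1 for every k (perfect discrimination of the states of A); (2) the identity operator 1 on ℂ^n ⊗ ℂ^m can be written as a finite nonnegative real linear combination of projections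 belonging to P_1 ∪ ⋯ ∪ P_N. -/
open Matrix Complex
open scoped Matrix Kronecker ComplexOrder

noncomputable section

theorem proj_kron {α β : Type*} (x : α → ℂ) (y : β → ℂ) :
    proj x ⊗ₖ proj y = proj (tens x y) := by
  ext ⟨i, a⟩ ⟨j, b⟩
  simp [proj, tens, Matrix.vecMulVec_apply, Matrix.kroneckerMap_apply]
  ring

theorem trace_proj_mul {α : Type*} [Fintype α] (a : α → ℂ) (P : Matrix α α ℂ) :
    (proj a * P).trace = star a ⬝ᵥ (P *ᵥ a) := by
  rw [proj, Matrix.vecMulVec_mul, Matrix.trace_vecMulVec, dotProduct_comm,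
    ← Matrix.dotProduct_mulVec]

theorem star_dot_swap {α : Type*} [Fintype α] (a b : α → ℂ) :
    star b ⬝ᵥ a = star (star a ⬝ᵥ b) := by
  rw [Matrix.star_dotProduct]

theorem quad_proj {α : Type*} [Fintype α] (a b : α → ℂ) :
    star a ⬝ᵥ (proj b *ᵥ a) = ((Complex.normSq (star a ⬝ᵥ b) : ℝ) : ℂ) := by
  rw [← trace_proj_mul, proj, proj, Matrix.vecMulVec_mul_vecMulVec, Matrix.trace_vecMulVec,
    dotProduct_comm, smul_dotProduct, Complex.normSq_eq_conj_mul_self, star_dot_swap a b]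
  simp [mul_comm]

open scoped MatrixOrder Matrix.Norms.L2Operator in
theorem psd_decomp {n : ℕ} {A : Matrix (Fin n) (Fin n) ℂ} (h : A.PosSemidef) :
    ∃ q : Fin n → Fin n → ℂ, A = ∑ i, proj (q i) := by
  obtain ⟨B, rfl⟩ := CStarAlgebra.nonneg_iff_eq_star_mul_self.mp h.nonneg
  refine ⟨fun i => star (B i), ?_⟩
  ext i j
  simp [proj, Matrix.mul_apply, Matrix.sum_apply, Matrix.vecMulVec_apply, Matrix.star_apply]

theorem sep_decomp {n m : ℕ} {P : Matrix (Fin n × Fin m) (Fin n × Fin m) ℂ} (h : SepMat P) :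
    ∃ (M : ℕ) (q : Fin M → Fin n → ℂ) (r : Fin M → Fin m → ℂ),
      P = ∑ j, proj (q j) ⊗ₖ proj (r j) := by
  obtain ⟨M, Q, R, hQ, hR, rfl⟩ := h
  choose q hq using fun j => psd_decomp (hQ j)
  choose r hr using fun j => psd_decomp (hR j)
  let e := (Fintype.equivFin (Fin M × Fin n × Fin m)).symm
  refine ⟨_, fun j => q (e j).1 (e j).2.1, fun j => r (e j).1 (e j).2.2, ?_⟩
  rw [e.sum_comp (fun t => proj (q t.1 t.2.1) ⊗ₖ proj (r t.1 t.2.2)), Fintype.sum_prod_type]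
  refine Finset.sum_congr rfl fun j _ => ?_
  rw [Fintype.sum_prod_type]
  conv_lhs => rw [hq j, hr j]
  ext ⟨i, a⟩ ⟨i', b⟩
  simp [Matrix.kroneckerMap_apply, Matrix.sum_apply, Finset.sum_mul_sum]

theorem normalize_vec {n : ℕ} (q : Fin n → ℂ) (hq : q ≠ 0) :
    ∃ (c : ℝ) (x : Fin n → ℂ), 0 < c ∧ star x ⬝ᵥ x = 1 ∧ q = (c : ℂ) • x := by
  have hp : 0 < star q ⬝ᵥ q := Matrix.dotProduct_star_self_pos_iff.mpr hq
  obtain ⟨hre, him⟩ := Complex.pos_iff.mp hp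
  set s := (star q ⬝ᵥ q).re with hs
  have hs' : star q ⬝ᵥ q = (s : ℂ) := Complex.ext (by simp [hs]) (by simp [← him])
  have hc : 0 < Real.sqrt s := Real.sqrt_pos.mpr hre
  have hc' : ((Real.sqrt s : ℝ) : ℂ) ≠ 0 := by exact_mod_cast hc.ne'
  refine ⟨Real.sqrt s, ((Real.sqrt s : ℝ) : ℂ)⁻¹ • q, hc, ?_, ?_⟩
  · rw [star_smul, smul_dotProduct, dotProduct_smul, hs']
    have : (s : ℂ) = (Real.sqrt s : ℂ) * (Real.sqrt s : ℂ) := by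
      exact_mod_cast (Real.mul_self_sqrt hre.le).symm
    rw [this]
    simp
    field_simp
  · rw [smul_smul, mul_inv_cancel₀ hc', one_smul]

theorem proj_real_smul {α : Type*} (c : ℝ) (x : α → ℂ) :
    proj ((c : ℂ) • x) = ((c ^ 2 : ℝ) : ℂ) • proj x := by
  ext i j
  simp [proj, Matrix.vecMulVec_apply]
  ring

theorem tens_smul {α β : Type*} (c d : ℂ) (x : α → ℂ) (y : β → ℂ) :
    tens (c • x) (d • y) = (c * d) • tens x y := by
  ext p
  simp [tens]
  ring

theorem unit_pair {n m N : ℕ} (u : Fin N → Fin n → ℂ) (v : Fin N → Fin m → ℂ) (k : Fin N)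
    (q : Fin n → ℂ) (r : Fin m → ℂ) (hq : q ≠ 0) (hr : r ≠ 0)
    (h : ∀ l, l ≠ k → star (tens (u l) (v l)) ⬝ᵥ tens q r = 0) :
    ∃ (t : ℝ) (x : Fin n → ℂ) (y : Fin m → ℂ), 0 ≤ t ∧ star x ⬝ᵥ x = 1 ∧ star y ⬝ᵥ y = 1 ∧
      (∀ l, l ≠ k → star (tens (u l) (v l)) ⬝ᵥ tens x y = 0) ∧
      proj q ⊗ₖ proj r = (t : ℂ) • (proj x ⊗ₖ proj y) := by
  obtain ⟨c, x, hc, hx, rfl⟩ := normalize_vec q hq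
  obtain ⟨d, y, hd, hy, rfl⟩ := normalize_vec r hr
  refine ⟨c ^ 2 * d ^ 2, x, y, by positivity, hx, hy, fun l hl => ?_, ?_⟩
  · have h1 := h l hl
    rw [tens_smul, dotProduct_smul, smul_eq_mul] at h1
    have : (c : ℂ) * d ≠ 0 := by exact_mod_cast (mul_pos hc hd).ne'
    exact (mul_eq_zero.mp h1).resolve_left this
  · rw [proj_real_smul, proj_real_smul, Matrix.smul_kronecker, Matrix.kronecker_smul, smul_smul]
    push_cast
    rfl

/-- Characterization of perfect discrimination of an unextendable product set by separable
measurements: a separable measurement perfectly discriminating the states of the unextendable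
product set `{u_k ⊗ v_k}` exists if and only if the identity can be written as a nonnegative
linear combination of rank-one product projections `xx* ⊗ yy*` with `x ⊗ y` orthogonal to
all members of the set except possibly the `k`-th one. -/
theorem ups_sep_discrimination_characterization (n m N : ℕ)
    (u : Fin N → Fin n → ℂ) (v : Fin N → Fin m → ℂ)
    (horth : ∀ k l, star (tens (u k) (v k)) ⬝ᵥ tens (u l) (v l) = if k = l then 1 else 0)
    (hups : ∀ (x : Fin n → ℂ) (y : Fin m → ℂ),
      (∀ k, star (tens (u k) (v k)) ⬝ᵥ tens x y = 0) → x = 0 ∨ y = 0) :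
    (∃ P : Fin N → Matrix (Fin n × Fin m) (Fin n × Fin m) ℂ,
        (∀ k, SepMat (P k)) ∧ (∑ k, P k = 1) ∧
        ∀ k, ((proj (u k) ⊗ₖ proj (v k)) * P k).trace = 1) ↔
    (∃ (M : Fin N → ℕ) (lam : (k : Fin N) → Fin (M k) → ℝ)
        (x : (k : Fin N) → Fin (M k) → Fin n → ℂ)
        (y : (k : Fin N) → Fin (M k) → Fin m → ℂ),
        (∀ k j, 0 ≤ lam k j) ∧
        (∀ k j, star (x k j) ⬝ᵥ x k j = 1) ∧
        (∀ k j, star (y k j) ⬝ᵥ y k j = 1) ∧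
        (∀ k j, ∀ l, l ≠ k → star (tens (u l) (v l)) ⬝ᵥ tens (x k j) (y k j) = 0) ∧
        (1 : Matrix (Fin n × Fin m) (Fin n × Fin m) ℂ) =
          ∑ k, ∑ j, (lam k j : ℂ) • (proj (x k j) ⊗ₖ proj (y k j))) := by
  constructor
  · rintro ⟨P, hP, hsum, htr⟩
    choose M q r hqr using fun k => sep_decomp (hP k)
    have hpos : ∀ k a, star a ⬝ᵥ (P k *ᵥ a) =
        ((∑ j, Complex.normSq (star a ⬝ᵥ tens (q k j) (r k j)) : ℝ) : ℂ) := by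
      intro k a
      rw [hqr k, Matrix.sum_mulVec, dotProduct_sum]
      push_cast
      refine Finset.sum_congr rfl fun j _ => ?_
      rw [proj_kron, quad_proj]
    have key : ∀ k j l, l ≠ k → star (tens (u l) (v l)) ⬝ᵥ tens (q k j) (r k j) = 0 := by
      intro k j l hl
      set a := tens (u l) (v l) with ha
      have h1 : ∑ k, star a ⬝ᵥ (P k *ᵥ a) = 1 := by
        rw [← dotProduct_sum, ← Matrix.sum_mulVec, hsum, Matrix.one_mulVec, ha, horth l l,
          if_pos rfl]
      have h2 : star a ⬝ᵥ (P l *ᵥ a) = 1 := by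
        rw [← trace_proj_mul, ha, ← proj_kron, htr l]
      rw [← Finset.add_sum_erase _ _ (Finset.mem_univ l), h2, add_eq_left] at h1
      simp only [hpos] at h1
      have h3 : ∑ k ∈ Finset.univ.erase l,
          ∑ j, Complex.normSq (star a ⬝ᵥ tens (q k j) (r k j)) = 0 := by exact_mod_cast h1
      rw [Finset.sum_eq_zero_iff_of_nonneg
        (fun _ _ => Finset.sum_nonneg fun _ _ => Complex.normSq_nonneg _)] at h3
      have h4 := h3 k (Finset.mem_erase.mpr ⟨hl.symm, Finset.mem_univ k⟩)
      rw [Finset.sum_eq_zero_iff_of_nonneg (fun _ _ => Complex.normSq_nonneg _)] at h4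
      exact Complex.normSq_eq_zero.mp (h4 j (Finset.mem_univ j))
    have hex : ∀ k j, ∃ (t : ℝ) (x : Fin n → ℂ) (y : Fin m → ℂ), 0 ≤ t ∧ star x ⬝ᵥ x = 1 ∧
        star y ⬝ᵥ y = 1 ∧ (∀ l, l ≠ k → star (tens (u l) (v l)) ⬝ᵥ tens x y = 0) ∧
        proj (q k j) ⊗ₖ proj (r k j) = (t : ℂ) • (proj x ⊗ₖ proj y) := by
      intro k j
      by_cases h0 : q k j = 0 ∨ r k j = 0
      · have hu : u k ≠ 0 := by
          intro h
          have := horth k k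
          simp [h, tens, dotProduct] at this
        have hv : v k ≠ 0 := by
          intro h
          have := horth k k
          simp [h, tens, dotProduct] at this
        obtain ⟨t, x, y, ht, hx, hy, ho, -⟩ := unit_pair u v k (u k) (v k) hu hv
          (fun l hl => by rw [horth, if_neg hl])
        refine ⟨0, x, y, le_rfl, hx, hy, ho, ?_⟩
        rcases h0 with h0 | h0 <;> simp [h0, proj]
      · push Not at h0
        exact unit_pair u v k _ _ h0.1 h0.2 (key k j)
    choose t x y ht hx hy ho he using hex
    refine ⟨M, t, x, y, ht, hx, hy, ho, ?_⟩
    rw [← hsum]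
    refine Finset.sum_congr rfl fun k _ => ?_
    rw [hqr k]
    exact Finset.sum_congr rfl fun j _ => he k j
  · rintro ⟨M, t, x, y, ht, hx, hy, ho, hsum⟩
    refine ⟨fun k => ∑ j, (t k j : ℂ) • (proj (x k j) ⊗ₖ proj (y k j)), fun k => ?_, hsum.symm,
      fun k => ?_⟩
    · refine ⟨M k, fun j => (t k j : ℂ) • proj (x k j), fun j => proj (y k j), fun j => ?_,
        fun j => Matrix.posSemidef_vecMulVec_self_star _, ?_⟩
      · exact (Matrix.posSemidef_vecMulVec_self_star _).smul (by exact_mod_cast ht k j)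
      · simp only [Matrix.smul_kronecker]
    · rw [proj_kron, trace_proj_mul]
      set a := tens (u k) (v k) with ha
      have h1 : star a ⬝ᵥ ((1 : Matrix (Fin n × Fin m) (Fin n × Fin m) ℂ) *ᵥ a) = 1 := by
        rw [Matrix.one_mulVec, ha, horth, if_pos rfl]
      rw [hsum, Matrix.sum_mulVec, dotProduct_sum, Finset.sum_eq_single k] at h1
      · exact h1
      · intro l _ hl
        rw [Matrix.sum_mulVec, dotProduct_sum]
        refine Finset.sum_eq_zero fun j _ => ?_
        rw [Matrix.smul_mulVec, dotProduct_smul, proj_kron, quad_proj, ha, ho l j k hl.symm]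
        simp
      · simp
end
end
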